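/- Consider n agents with local gradient maps g_1, …, g_n : ℝ^d → ℝ^d, a point x⋆ ∈ ℝ^d with (1/n)·Σ_{i=1}^n g_i(x⋆) = 0, a stepsize α > 0 and contraction factor ρ ∈ (0,1) such that ‖x − x⋆ − α(g_i(x) − g_i(x⋆))‖ ≤ ρ‖x − x⋆‖ for all x ∈ ℝ^d and all i. Let σ ∈ (0,1), let σ₀ = (√(1+ρ) − √(1−ρ))/2, and let m be a positive integer with σ^m ≤ σ₀. For every iteration k ≥ 0 and every step ℓ ∈ {1,…,m}, let W^{k,ℓ} ∈ ℝ^{n×n} be a doubly stochastic matrix with ‖W^{k,ℓ} − (1/n)𝟙𝟙ᵀ‖ ≤ σ (induced 2-norm). Suppose the iterates are generated by: initial values x_i^0, y_i^0 ∈ ℝ^d with Σ_{i=1}^n y_i^0 = 0; v_{i,0}^k = x_i^k; v_{i,ℓ}^k = Σ_{j=1}^n w_{ij}^{k,ℓ} v_{j,ℓ−1}^k for ℓ = 1,…,m; u_i^k = v_{i,m}^k − α·g_i(v_{i,m}^k); y_i^{k+1} = y_i^k + x_i^k − v_{i,m}^k; and x_i^{k+1} = u_i^k − √(1−ρ²)·y_i^{k+1}.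 Then there exists a constant c ≥ 0 such that ‖x_i^k − x⋆‖ ≤ c·ρ^k for every agent i ∈ {1,…,n} and every iteration k ≥ 0. -/

import Mathlib

/-- The spectral gap norm: induced 2-norm of a matrix, viewed as an operator on
Euclidean space. -/
noncomputable def sgap {n : ℕ} (M : Matrix (Fin n) (Fin n) ℝ) : ℝ :=
  ‖Matrix.toEuclideanCLM (𝕜 := ℝ) M‖

/-- The all-ones matrix `𝟙𝟙ᵀ`. -/
def oneOneT (n : ℕ) : Matrix (Fin n) (Fin n) ℝ := Matrix.of fun _ _ => 1

/-- A matrix is doubly stochastic if `W𝟙 = 𝟙` and `𝟙ᵀW = 𝟙ᵀ`. -/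
def IsDoublyStochastic {n : ℕ} (M : Matrix (Fin n) (Fin n) ℝ) : Prop :=
  M.mulVec (fun _ => (1 : ℝ)) = (fun _ => (1 : ℝ)) ∧
    Matrix.vecMul (fun _ => (1 : ℝ)) M = (fun _ => (1 : ℝ))

open scoped RealInnerProductSpace

/-- The induced 2-norm of a matrix bounds its action on families of vectors. -/
lemma sum_norm_sq_matrix_smul_le {n d : ℕ} (M : Matrix (Fin n) (Fin n) ℝ)
    (w : Fin n → EuclideanSpace ℝ (Fin d)) :
    ∑ i, ‖∑ j, M i j • w j‖ ^ 2 ≤ sgap M ^ 2 * ∑ i, ‖w i‖ ^ 2 := by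
  simp only [EuclideanSpace.norm_sq_eq, Real.norm_eq_abs, sq_abs]
  rw [Finset.sum_comm, Finset.sum_comm (f := fun i c => (w i) c ^ 2), Finset.mul_sum]
  refine Finset.sum_le_sum fun c _ => ?_
  have h := (Matrix.toEuclideanCLM (𝕜 := ℝ) M).le_opNorm (WithLp.toLp 2 fun j => w j c)
  have h2 := pow_le_pow_left₀ (norm_nonneg _) h 2
  rw [mul_pow] at h2
  simpa [EuclideanSpace.norm_sq_eq, Matrix.mulVec, dotProduct, sgap] using h2

/-- One gossip round preserves the mean and contracts the deviation from it. -/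
lemma IsDoublyStochastic.gossip_step {n d : ℕ} {W : Matrix (Fin n) (Fin n) ℝ} {σ : ℝ}
    (hW : IsDoublyStochastic W) (hgap : sgap (W - (n : ℝ)⁻¹ • oneOneT n) ≤ σ)
    {v v' : Fin n → EuclideanSpace ℝ (Fin d)} {b : EuclideanSpace ℝ (Fin d)}
    (hv' : ∀ i, v' i = ∑ j, W i j • v j) (hb : ∑ i, (v i - b) = 0) :
    ∑ i, (v' i - b) = 0 ∧ ∑ i, ‖v' i - b‖ ^ 2 ≤ σ ^ 2 * ∑ i, ‖v i - b‖ ^ 2 := by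
  have hrow : ∀ i, ∑ j, W i j = 1 := fun i => by
    simpa [Matrix.mulVec, dotProduct] using congrFun hW.1 i
  have hcol : ∀ j, ∑ i, W i j = 1 := fun j => by
    simpa [Matrix.vecMul, dotProduct] using congrFun hW.2 j
  have hdev : ∀ i, v' i - b = ∑ j, W i j • (v j - b) := fun i => by
    simp [hv', smul_sub, Finset.sum_sub_distrib, ← Finset.sum_smul, hrow]
  refine ⟨?_, ?_⟩
  · simp only [hdev]
    rw [Finset.sum_comm]
    simpa [← Finset.sum_smul, hcol] using hb
  · have hdev' : ∀ i, v' i - b =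
        ∑ j, (W - (n : ℝ)⁻¹ • oneOneT n) i j • (v j - b) := fun i => by
      simp only [hdev, oneOneT, Matrix.sub_apply, Matrix.smul_apply, Matrix.of_apply, sub_smul,
        Finset.sum_sub_distrib (f := fun j => W i j • (v j - b)), ← Finset.smul_sum, hb,
        smul_eq_mul, mul_one, smul_zero, sub_zero]
    simp only [hdev']
    refine (sum_norm_sq_matrix_smul_le _ _).trans ?_
    have h0 : 0 ≤ sgap (W - (n : ℝ)⁻¹ • oneOneT n) := norm_nonneg _
    gcongr

/-- The pointwise algebraic identity behind the decrease of the Lyapunov function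
`∑ ‖e + s z‖² + s (1 - s) ∑ ‖z‖²`, where `e = a + p` and `V = a + q`. -/
lemma lyapunov_identity {E : Type*} [NormedAddCommGroup E] [InnerProductSpace ℝ E]
    (a p q z : E) (s : ℝ) :
    (1 - s ^ 2) * (‖a + p + s • z‖ ^ 2 + s * (1 - s) * ‖z‖ ^ 2)
      - ((1 - s ^ 2) * ‖a + q‖ ^ 2 + s * (1 - s) * ‖z + p - q‖ ^ 2)
      = 2 * (1 - s ^ 2) * ((1 - s) / 2 * ‖p‖ ^ 2 - ‖q‖ ^ 2)
        + (1 - s) * ‖q + s • (p + z)‖ ^ 2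
        + 2 * (1 - s ^ 2) * ⟪a, p + s • z - q⟫ := by
  simp only [← real_inner_self_eq_norm_sq, inner_add_left, inner_add_right, inner_sub_left,
    inner_sub_right, real_inner_smul_left, real_inner_smul_right]
  rw [real_inner_comm a p, real_inner_comm a q, real_inner_comm a z, real_inner_comm p q,
    real_inner_comm p z, real_inner_comm q z]
  ring

/-- Summed form of the Lyapunov decrease for mean-zero deviations `p`, `q`, `z`. -/
lemma lyapunov_sum_le {ι E : Type*} [Fintype ι] [NormedAddCommGroup E] [InnerProductSpace ℝ E]
    (a : E) (p q z : ι → E) {s : ℝ} (hs0 : 0 ≤ s) (hs1 : s ≤ 1)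
    (hp : ∑ i, p i = 0) (hq : ∑ i, q i = 0) (hz : ∑ i, z i = 0)
    (hpq : ∑ i, ‖q i‖ ^ 2 ≤ (1 - s) / 2 * ∑ i, ‖p i‖ ^ 2) :
    (1 - s ^ 2) * ∑ i, ‖a + q i‖ ^ 2 + s * (1 - s) * ∑ i, ‖z i + p i - q i‖ ^ 2 ≤
      (1 - s ^ 2) * (∑ i, ‖a + p i + s • z i‖ ^ 2 + s * (1 - s) * ∑ i, ‖z i‖ ^ 2) := by
  have key := Finset.sum_congr (s₁ := Finset.univ) rfl
    fun i _ => lyapunov_identity a (p i) (q i) (z i) s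
  have hinner : ∑ i, ⟪a, p i + s • z i - q i⟫ = 0 := by
    rw [← inner_sum, Finset.sum_sub_distrib, Finset.sum_add_distrib, ← Finset.smul_sum, hp, hq, hz]
    simp
  simp only [Finset.sum_add_distrib, Finset.sum_sub_distrib, ← Finset.mul_sum, hinner] at key
  have h1 : 0 ≤ (1 - s) * ∑ i, ‖q i + s • (p i + z i)‖ ^ 2 :=
    mul_nonneg (by linarith) (Finset.sum_nonneg fun _ _ => sq_nonneg _)
  have h2 : 0 ≤ 2 * (1 - s ^ 2) *
      ((1 - s) / 2 * ∑ i, ‖p i‖ ^ 2 - ∑ i, ‖q i‖ ^ 2) :=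
    mul_nonneg (by nlinarith) (by linarith)
  linarith


/-- Main convergence theorem: the iterates of the distributed algorithm converge to the
global optimizer `x⋆` linearly with rate `ρ`. -/
theorem main_convergence {n d : ℕ} (hn : 0 < n)
    (g : Fin n → EuclideanSpace ℝ (Fin d) → EuclideanSpace ℝ (Fin d))
    (xstar : EuclideanSpace ℝ (Fin d))
    (hopt : (n : ℝ)⁻¹ • ∑ i, g i xstar = 0)
    (α ρ σ : ℝ) (hα : 0 < α) (hρ : 0 < ρ ∧ ρ < 1) (hσ : 0 < σ ∧ σ < 1)
    (hcontr : ∀ (x : EuclideanSpace ℝ (Fin d)) (i : Fin n),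
      ‖x - xstar - α • (g i x - g i xstar)‖ ≤ ρ * ‖x - xstar‖)
    (σ₀ : ℝ) (hσ₀ : σ₀ = (Real.sqrt (1 + ρ) - Real.sqrt (1 - ρ)) / 2)
    (m : ℕ) (hm : 0 < m) (hσm : σ ^ m ≤ σ₀)
    -- `W k ℓ` is the gossip matrix at iteration `k`, communication round `ℓ` (`ℓ < m`)
    (W : ℕ → ℕ → Matrix (Fin n) (Fin n) ℝ)
    (hWds : ∀ k ℓ, ℓ < m → IsDoublyStochastic (W k ℓ))
    (hWgap : ∀ k ℓ, ℓ < m → sgap (W k ℓ - (n : ℝ)⁻¹ • oneOneT n) ≤ σ)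
    -- the iterates of the algorithm
    (x y : ℕ → Fin n → EuclideanSpace ℝ (Fin d))
    (v : ℕ → ℕ → Fin n → EuclideanSpace ℝ (Fin d))
    (hy0 : ∑ i, y 0 i = 0)
    (hv0 : ∀ k i, v k 0 i = x k i)
    (hv : ∀ k ℓ, ℓ < m → ∀ i, v k (ℓ + 1) i = ∑ j, W k ℓ i j • v k ℓ j)
    (hy : ∀ k i, y (k + 1) i = y k i + x k i - v k m i)
    (hx : ∀ k i, x (k + 1) i =
      (v k m i - α • g i (v k m i)) - Real.sqrt (1 - ρ ^ 2) • y (k + 1) i) :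
    ∃ c : ℝ, 0 ≤ c ∧ ∀ (i : Fin n) (k : ℕ), ‖x k i - xstar‖ ≤ c * ρ ^ k := by
  obtain ⟨hρ0, hρ1⟩ := hρ
  set s := Real.sqrt (1 - ρ ^ 2) with hs
  have hs2 : s ^ 2 = 1 - ρ ^ 2 := Real.sq_sqrt (by nlinarith)
  have hs0 : 0 < s := Real.sqrt_pos.2 (by nlinarith)
  have hs1 : s < 1 := by nlinarith
  have hσ₀sq : σ₀ ^ 2 = (1 - s) / 2 := by
    have h1 := Real.sq_sqrt (show 0 ≤ 1 + ρ by linarith)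
    have h2 := Real.sq_sqrt (show 0 ≤ 1 - ρ by linarith)
    have h3 : Real.sqrt (1 + ρ) * Real.sqrt (1 - ρ) = s := by
      rw [← Real.sqrt_mul (by linarith), hs]
      ring_nf
    rw [hσ₀]
    linear_combination h1 / 4 + h2 / 4 - h3 / 2
  have hn' : (n : ℝ) ≠ 0 := by positivity
  have hgsum : ∑ i, g i xstar = 0 := (smul_eq_zero.1 hopt).resolve_left (inv_ne_zero hn')
  have hgossip : ∀ k b, ∑ i, (x k i - b) = 0 → ∀ ℓ ≤ m, ∑ i, (v k ℓ i - b) = 0 ∧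
      ∑ i, ‖v k ℓ i - b‖ ^ 2 ≤ (σ ^ ℓ) ^ 2 * ∑ i, ‖x k i - b‖ ^ 2 := by
    intro k b hb ℓ
    induction ℓ with
    | zero => intro _; simp [hv0, hb]
    | succ ℓ ih =>
      intro hℓ
      obtain ⟨h1, h2⟩ := ih (by omega)
      obtain ⟨h3, h4⟩ := (hWds k ℓ hℓ).gossip_step (hWgap k ℓ hℓ) (hv k ℓ hℓ) h1
      refine ⟨h3, h4.trans ?_⟩
      calc _ ≤ σ ^ 2 * ((σ ^ ℓ) ^ 2 * ∑ i, ‖x k i - b‖ ^ 2) := by gcongr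
        _ = _ := by ring
  have hmean : ∀ k, ∑ i, (x k i - (n : ℝ)⁻¹ • ∑ j, x k j) = 0 := fun k => by
    rw [Finset.sum_sub_distrib, Finset.sum_const, Finset.card_univ, Fintype.card_fin,
      ← Nat.cast_smul_eq_nsmul ℝ, smul_smul, mul_inv_cancel₀ hn', one_smul, sub_self]
  have hysum : ∀ k, ∑ i, y k i = 0 := by
    intro k
    induction k with
    | zero => exact hy0
    | succ k ih =>
      have h1 := hmean k
      have h2 := (hgossip k _ h1 m le_rfl).1
      have h3 : ∑ i, (x k i - v k m i) = 0 := by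
        simpa [← Finset.sum_sub_distrib] using congrArg₂ (· - ·) h1 h2
      calc ∑ i, y (k + 1) i = ∑ i, y k i + ∑ i, (x k i - v k m i) := by
            simp only [hy, add_sub_assoc, Finset.sum_add_distrib]
        _ = 0 := by rw [ih, h3, add_zero]
  let z : ℕ → Fin n → EuclideanSpace ℝ (Fin d) := fun k i => y k i + (α / s) • g i xstar
  have hzsum : ∀ k, ∑ i, z k i = 0 := fun k => by
    simp [z, Finset.sum_add_distrib, hysum, ← Finset.smul_sum, hgsum]
  let L : ℕ → ℝ := fun k =>
    ∑ i, ‖x k i - xstar + s • z k i‖ ^ 2 + s * (1 - s) * ∑ i, ‖z k i‖ ^ 2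
  have hκ : 0 < s * (1 - s) := mul_pos hs0 (by linarith)
  have hstep : ∀ k, L (k + 1) ≤ ρ ^ 2 * L k := by
    intro k
    set b := (n : ℝ)⁻¹ • ∑ j, x k j with hbdef
    obtain ⟨h1, h2⟩ := hgossip k b (hmean k) m le_rfl
    have hq : ∑ i, ‖v k m i - b‖ ^ 2 ≤ (1 - s) / 2 * ∑ i, ‖x k i - b‖ ^ 2 := by
      rw [← hσ₀sq]
      have h0 : 0 ≤ σ ^ m := pow_nonneg hσ.1.le m
      exact h2.trans (by gcongr)
    have key := lyapunov_sum_le (b - xstar) (fun i => x k i - b) (fun i => v k m i - b) (z k)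
      hs0.le hs1.le (hmean k) h1 (hzsum k) hq
    have hρs : 1 - s ^ 2 = ρ ^ 2 := by linarith
    rw [hρs] at key
    have hT : ∀ i, ‖x (k + 1) i - xstar + s • z (k + 1) i‖ ^ 2 ≤
        ρ ^ 2 * ‖b - xstar + (v k m i - b)‖ ^ 2 := fun i => by
      have h3 : x (k + 1) i - xstar + s • z (k + 1) i =
          v k m i - xstar - α • (g i (v k m i) - g i xstar) := by
        simp only [z, hx, smul_add, smul_smul, mul_div_cancel₀ α hs0.ne', smul_sub]
        abel
      have h4 : b - xstar + (v k m i - b) = v k m i - xstar := by abel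
      rw [h3, h4, ← mul_pow]
      exact pow_le_pow_left₀ (norm_nonneg _) (hcontr _ i) 2
    have hT' := Finset.sum_le_sum fun i (_ : i ∈ Finset.univ) => hT i
    rw [← Finset.mul_sum] at hT'
    have hz : ∀ i, z k i + (x k i - b) - (v k m i - b) = z (k + 1) i := fun i => by
      simp only [z, hy]
      abel
    have he : ∀ i, b - xstar + (x k i - b) = x k i - xstar := fun i => by abel
    simp only [hz, he] at key
    simp only [L]
    linarith
  have hL : ∀ k, L k ≤ L 0 * (ρ ^ k) ^ 2 := by
    intro k
    induction k with
    | zero => simp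
    | succ k ih =>
      calc L (k + 1) ≤ ρ ^ 2 * (L 0 * (ρ ^ k) ^ 2) := (hstep k).trans (by gcongr)
        _ = _ := by ring
  have hL0 : 0 ≤ L 0 := by positivity
  refine ⟨Real.sqrt (L 0) + s * Real.sqrt (L 0 / (s * (1 - s))), by positivity, fun i k => ?_⟩
  have hρk : 0 ≤ ρ ^ k := by positivity
  have hsum1 : ‖x k i - xstar + s • z k i‖ ^ 2 ≤ ∑ j, ‖x k j - xstar + s • z k j‖ ^ 2 :=
    Finset.single_le_sum (f := fun j => ‖x k j - xstar + s • z k j‖ ^ 2)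
      (fun _ _ => sq_nonneg _) (Finset.mem_univ i)
  have hsum2 : ‖z k i‖ ^ 2 ≤ ∑ j, ‖z k j‖ ^ 2 :=
    Finset.single_le_sum (f := fun j => ‖z k j‖ ^ 2)
      (fun _ _ => sq_nonneg _) (Finset.mem_univ i)
  have hn1 : ‖x k i - xstar + s • z k i‖ ≤ Real.sqrt (L 0) * ρ ^ k := by
    refine (sq_le_sq₀ (norm_nonneg _) (by positivity)).1 ?_
    rw [mul_pow, Real.sq_sqrt hL0]
    have : 0 ≤ s * (1 - s) * ∑ j, ‖z k j‖ ^ 2 := by positivity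
    linarith [hL k, show L k = _ from rfl]
  have hn2 : ‖z k i‖ ≤ Real.sqrt (L 0 / (s * (1 - s))) * ρ ^ k := by
    refine (sq_le_sq₀ (norm_nonneg _) (by positivity)).1 ?_
    rw [mul_pow, Real.sq_sqrt (by positivity), div_mul_eq_mul_div, le_div_iff₀ hκ]
    have : 0 ≤ ∑ j, ‖x k j - xstar + s • z k j‖ ^ 2 := by positivity
    have := mul_le_mul_of_nonneg_left hsum2 hκ.le
    linarith [hL k, show L k = _ from rfl]
  calc ‖x k i - xstar‖ = ‖(x k i - xstar + s • z k i) - s • z k i‖ := by rw [add_sub_cancel_right]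
    _ ≤ ‖x k i - xstar + s • z k i‖ + ‖s • z k i‖ := norm_sub_le _ _
    _ = ‖x k i - xstar + s • z k i‖ + s * ‖z k i‖ := by
      rw [norm_smul, Real.norm_of_nonneg hs0.le]
    _ ≤ Real.sqrt (L 0) * ρ ^ k + s * (Real.sqrt (L 0 / (s * (1 - s))) * ρ ^ k) := by gcongr
    _ = _ := by ring
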